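/- Fix a real number c > 0 and for each n set t_n = ⌊cn + (n/2)·ln k⌋. If k = 3 then liminf_{n→∞} ‖μ_{t_n+1} − U_{t_n+1}‖_TV ≥ (4/55)·e^{−4c}, and for every fixed integer k ≥ 4, liminf_{n→∞} ‖μ_{t_n+1} − U_{t_n+1}‖_TV ≥ (3/35)·e^{−4c}. -/

import Mathlib

-- Common setup for the random (n-k)-cycle to transpositions walk on the symmetric group.
open Finset Filter Real

noncomputable section

/-- Convolution of two (probability) distributions on `S_n`. -/
def conv {n : ℕ} (μ ν : Equiv.Perm (Fin n) → ℝ) : Equiv.Perm (Fin n) → ℝ :=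
  fun g => ∑ h : Equiv.Perm (Fin n), μ (g * h⁻¹) * ν h

/-- `t`-fold convolution power (with `μ^{*0}` the point mass at the identity). -/
def convPow {n : ℕ} (μ : Equiv.Perm (Fin n) → ℝ) : ℕ → (Equiv.Perm (Fin n) → ℝ)
  | 0 => fun g => if g = 1 then 1 else 0
  | t + 1 => conv (convPow μ t) μ

/-- Uniform probability distribution on a finite set of permutations. -/
def unifOn {n : ℕ} (S : Finset (Equiv.Perm (Fin n))) : Equiv.Perm (Fin n) → ℝ :=
  fun g => if g ∈ S then (1 : ℝ) / S.card else 0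

/-- The set of `(n-k)`-cycles of `S_n`: one cycle of length `n - k` and `k` fixed points. -/
def cycles (n k : ℕ) : Finset (Equiv.Perm (Fin n)) :=
  letI := Classical.decPred fun σ : Equiv.Perm (Fin n) => σ.IsCycle ∧ σ.support.card = n - k
  Finset.univ.filter fun σ : Equiv.Perm (Fin n) => σ.IsCycle ∧ σ.support.card = n - k

/-- The set of transpositions of `S_n`. -/
def transpositions (n : ℕ) : Finset (Equiv.Perm (Fin n)) :=
  letI := Classical.decPred fun σ : Equiv.Perm (Fin n) => σ.IsSwap
  Finset.univ.filter fun σ : Equiv.Perm (Fin n) => σ.IsSwap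

/-- The law `μ_{t+1} = ν_n * τ_n^{*t}` of the walk after the initial random `(n-k)`-cycle
and `t` random transpositions. -/
def walk (n k t : ℕ) : Equiv.Perm (Fin n) → ℝ :=
  conv (unifOn (cycles n k)) (convPow (unifOn (transpositions n)) t)

/-- The alternating group `A_n` as a finset. -/
def evenPerms (n : ℕ) : Finset (Equiv.Perm (Fin n)) :=
  Finset.univ.filter fun σ => Equiv.Perm.sign σ = 1

/-- `S_n \ A_n` as a finset. -/
def oddPerms (n : ℕ) : Finset (Equiv.Perm (Fin n)) :=
  Finset.univ.filter fun σ => ¬ (Equiv.Perm.sign σ = 1)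

/-- The stationary distribution `U_s` at step `s`: uniform on `A_n` if `s` and `n - k`
have the same parity, uniform on `S_n \ A_n` otherwise. -/
def stationary (n k s : ℕ) : Equiv.Perm (Fin n) → ℝ :=
  if s % 2 = (n - k) % 2 then unifOn (evenPerms n) else unifOn (oddPerms n)

/-- Total variation distance between two distributions on `S_n`. -/
def tvDist {n : ℕ} (μ ν : Equiv.Perm (Fin n) → ℝ) : ℝ :=
  (1 / 2) * ∑ σ : Equiv.Perm (Fin n), |μ σ - ν σ|

/-- The number of fixed points of a permutation. -/
def fixCount {n : ℕ} (σ : Equiv.Perm (Fin n)) : ℕ :=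
  (Finset.univ.filter fun i => σ i = i).card

end


def ev {n : ℕ} (μ f : Equiv.Perm (Fin n) → ℝ) : ℝ := ∑ g, μ g * f g

def IsProb {n : ℕ} (μ : Equiv.Perm (Fin n) → ℝ) : Prop := (∀ g, 0 ≤ μ g) ∧ ∑ g, μ g = 1

theorem ev_conv {n : ℕ} (μ ν f : Equiv.Perm (Fin n) → ℝ) :
    ev (conv μ ν) f = ∑ g, μ g * ∑ h, ν h * f (g * h) := by
  unfold ev conv
  simp_rw [Finset.sum_mul, Finset.mul_sum]
  rw [Finset.sum_comm]
  conv_rhs => rw [Finset.sum_comm]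
  refine Finset.sum_congr rfl fun h _ => ?_
  rw [← Equiv.sum_comp (Equiv.mulRight h)]
  refine Finset.sum_congr rfl fun g _ => ?_
  simp [mul_assoc]

theorem conv_assoc {n : ℕ} (μ ν ρ : Equiv.Perm (Fin n) → ℝ) :
    conv μ (conv ν ρ) = conv (conv μ ν) ρ := by
  funext g
  unfold conv
  simp_rw [Finset.sum_mul, Finset.mul_sum]
  rw [Finset.sum_comm]
  refine Finset.sum_congr rfl fun h _ => ?_
  rw [← Equiv.sum_comp (Equiv.mulRight h)]
  refine Finset.sum_congr rfl fun k _ => ?_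
  simp [mul_assoc]

theorem conv_one {n : ℕ} (μ : Equiv.Perm (Fin n) → ℝ) :
    conv μ (fun g => if g = 1 then 1 else 0) = μ := by
  funext g
  simp [conv]

theorem walk_succ (n k t : ℕ) :
    walk n k (t + 1) = conv (walk n k t) (unifOn (transpositions n)) := by
  unfold walk
  rw [convPow, conv_assoc]

theorem walk_zero (n k : ℕ) : walk n k 0 = unifOn (cycles n k) := by
  unfold walk
  rw [convPow, conv_one]

theorem unifOn_isProb {n : ℕ} (S : Finset (Equiv.Perm (Fin n))) (hS : S.Nonempty) :
    IsProb (unifOn S) := by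
  constructor
  · intro g
    unfold unifOn
    split_ifs <;> positivity
  · have : (S.card : ℝ) ≠ 0 := by
      have := hS.card_pos
      positivity
    simp [unifOn, Finset.sum_ite_mem, this]

theorem conv_isProb {n : ℕ} (μ ν : Equiv.Perm (Fin n) → ℝ) (hμ : IsProb μ) (hν : IsProb ν) :
    IsProb (conv μ ν) := by
  constructor
  · intro g
    exact Finset.sum_nonneg fun h _ => mul_nonneg (hμ.1 _) (hν.1 _)
  · have := ev_conv μ ν (fun _ => 1)
    simp only [ev, mul_one, hν.2, hμ.2] at this
    exact this

theorem mem_trans {n : ℕ} (σ : Equiv.Perm (Fin n)) : σ ∈ transpositions n ↔ σ.IsSwap := by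
  simp [transpositions]

theorem sum_trans {n : ℕ} (F : Equiv.Perm (Fin n) → ℝ) :
    ∑ i, ∑ j, F (Equiv.swap i j) = n * F 1 + 2 * ∑ τ ∈ transpositions n, F τ := by
  classical
  have h1 : ∀ i j : Fin n, F (Equiv.swap i j) = (if i = j then F 1 else 0) +
      ∑ τ ∈ transpositions n, if i ≠ j ∧ τ = Equiv.swap i j then F τ else 0 := by
    intro i j
    by_cases h : i = j
    · subst h
      simp
      rfl
    · simp only [h, ne_eq, not_false_eq_true, true_and, if_false, zero_add]
      rw [Finset.sum_ite_eq', if_pos]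
      rw [mem_trans]
      exact ⟨i, j, h, rfl⟩
  simp_rw [h1, Finset.sum_add_distrib]
  congr 1
  · simp
  · have : ∀ i : Fin n, ∑ j, ∑ τ ∈ transpositions n, (if i ≠ j ∧ τ = Equiv.swap i j then F τ else 0)
      = ∑ τ ∈ transpositions n, if τ i ≠ i then F τ else 0 := by
      intro i
      rw [Finset.sum_comm]
      refine Finset.sum_congr rfl fun τ hτ => ?_
      rw [mem_trans] at hτ
      have : ∀ j, (i ≠ j ∧ τ = Equiv.swap i j) ↔ (j = τ i ∧ τ i ≠ i) := by
        intro j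
        obtain ⟨a, b, hab, rfl⟩ := hτ
        constructor
        · rintro ⟨h, h2⟩
          rw [h2]; simp [h.symm]
        · rintro ⟨rfl, h2⟩
          refine ⟨h2.symm, ?_⟩
          rcases eq_or_ne i a with rfl | h3
          · simp
          rcases eq_or_ne i b with rfl | h4
          · simp [Equiv.swap_comm]
          · exact absurd (Equiv.swap_apply_of_ne_of_ne h3 h4) h2
      simp_rw [this]
      by_cases h : τ i = i <;> simp [h]
    simp_rw [this]
    rw [Finset.sum_comm, Finset.mul_sum]
    refine Finset.sum_congr rfl fun τ hτ => ?_
    rw [mem_trans] at hτ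
    rw [← Finset.sum_filter, Finset.sum_const, nsmul_eq_mul]
    congr 1
    have h2 := Equiv.Perm.card_support_eq_two.2 hτ
    have : (Finset.univ.filter fun i => τ i ≠ i) = τ.support := by ext; simp
    rw [this, h2]; norm_num

theorem card_trans (n : ℕ) : 2 * ((transpositions n).card : ℝ) = n * (n - 1) := by
  have := sum_trans (n := n) (fun _ => 1)
  simp at this
  linarith

theorem sum_erase2 {n : ℕ} (x y : Fin n) (h : x ≠ y) (φ : Fin n → ℝ) :
    ∑ i, φ i = φ x + φ y + ∑ i ∈ (Finset.univ.erase x).erase y, φ i := by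
  rw [← Finset.add_sum_erase _ _ (Finset.mem_univ x), ← Finset.add_sum_erase (Finset.univ.erase x) _ (a := y) (by simp [h.symm])]
  ring

theorem swap_sum1 {n : ℕ} (x : Fin n) (H : Fin n → ℝ) :
    ∑ i, ∑ j, H (Equiv.swap i j x) = ((n - 1) ^ 2 - 1) * H x + 2 * ∑ y, H y := by
  have hn : 1 ≤ n := x.pos
  have e : ∀ φ : Fin n → ℝ, ∑ i, φ i = φ x + ∑ i ∈ Finset.univ.erase x, φ i := fun φ => by
    rw [← Finset.add_sum_erase _ _ (Finset.mem_univ x)]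
  have h1 : ∀ i ∈ Finset.univ.erase x, ∑ j, H (Equiv.swap i j x) = H i + (n-1) * H x := by
    intro i hi
    simp at hi
    rw [e]
    rw [Finset.sum_congr rfl (g := fun _ => H x)]
    · simp [hn]
    · intro j hj
      simp at hj
      rw [Equiv.swap_apply_of_ne_of_ne (Ne.symm hi) (Ne.symm hj)]
  rw [e, Finset.sum_congr rfl h1, Finset.sum_add_distrib]
  have := e H
  simp [hn]
  rw [this]
  ring

theorem swap_sum2 {n : ℕ} (x y : Fin n) (h : x ≠ y) (H : Fin n → Fin n → ℝ) :
    ∑ i, ∑ j, H (Equiv.swap i j x) (Equiv.swap i j y) =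
      (2 + (n - 2) ^ 2) * H x y + 2 * H y x
      + 2 * ∑ z ∈ (Finset.univ.erase x).erase y, H z y
      + 2 * ∑ z ∈ (Finset.univ.erase x).erase y, H x z := by
  have hn : 2 ≤ n := by
    have := x.2; have := y.2
    by_contra hh
    apply h; ext; omega
  have hc : (((Finset.univ.erase x).erase y).card : ℝ) = n - 2 := by
    rw [Finset.card_erase_of_mem (by simp [h.symm]), Finset.card_erase_of_mem (by simp)]
    simp only [Finset.card_univ, Fintype.card_fin]
    rw [Nat.sub_sub, Nat.cast_sub hn]; norm_num
  have h1 : ∀ i ∈ (Finset.univ.erase x).erase y, ∑ j, H (Equiv.swap i j x) (Equiv.swap i j y)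
      = H i y + H x i + (n-2) * H x y := by
    intro i hi
    simp at hi
    rw [sum_erase2 x y h]
    rw [Finset.sum_congr rfl (g := fun _ => H x y)]
    · rw [Finset.sum_const, nsmul_eq_mul, hc, Equiv.swap_apply_right, Equiv.swap_apply_right,
        Equiv.swap_apply_of_ne_of_ne (Ne.symm hi.1) h.symm,
        Equiv.swap_apply_of_ne_of_ne (Ne.symm hi.2) h]
    · intro j hj
      simp at hj
      rw [Equiv.swap_apply_of_ne_of_ne (Ne.symm hi.2) (Ne.symm hj.2), Equiv.swap_apply_of_ne_of_ne (Ne.symm hi.1) (Ne.symm hj.1)]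
  have h2 : ∑ j, H (Equiv.swap x j x) (Equiv.swap x j y) = H x y + H y x + ∑ z ∈ (Finset.univ.erase x).erase y, H z y := by
    rw [sum_erase2 x y h]
    congr 1
    · simp
    · refine Finset.sum_congr rfl fun j hj => ?_
      simp at hj
      rw [Equiv.swap_apply_left, Equiv.swap_apply_of_ne_of_ne h.symm (Ne.symm hj.1)]
  have h3 : ∑ j, H (Equiv.swap y j x) (Equiv.swap y j y) = H y x + H x y + ∑ z ∈ (Finset.univ.erase x).erase y, H x z := by
    rw [sum_erase2 x y h]
    congr 1
    · simp
    · refine Finset.sum_congr rfl fun j hj => ?_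
      simp at hj
      rw [Equiv.swap_apply_left, Equiv.swap_apply_of_ne_of_ne h (Ne.symm hj.2)]
  rw [sum_erase2 x y h, h2, h3, Finset.sum_congr rfl h1]
  simp only [Finset.sum_add_distrib, Finset.sum_const, nsmul_eq_mul, hc]
  ring

/-- fixed points -/
def ff {n : ℕ} (g : Equiv.Perm (Fin n)) : ℝ := ∑ x, if g x = x then 1 else 0

/-- ordered pairs of distinct fixed points -/
def f2 {n : ℕ} (g : Equiv.Perm (Fin n)) : ℝ :=
  ∑ x, ∑ y ∈ Finset.univ.erase x, (if g x = x then 1 else 0) * (if g y = y then 1 else 0)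

/-- ordered pairs of swapped points -/
def c2 {n : ℕ} (g : Equiv.Perm (Fin n)) : ℝ :=
  ∑ x, ∑ y ∈ Finset.univ.erase x, (if g x = y then 1 else 0) * (if g y = x then 1 else 0)

theorem sum_ind {n : ℕ} (g : Equiv.Perm (Fin n)) (x : Fin n) :
    ∑ y, (if g y = x then (1:ℝ) else 0) = 1 := by
  have : ∀ y, g y = x ↔ y = g.symm x := fun y => by rw [Equiv.eq_symm_apply]
  simp [this]

theorem drift_ff {n : ℕ} (g : Equiv.Perm (Fin n)) :
    2 * ∑ τ ∈ transpositions n, ff (g * τ) = ((n:ℝ) ^ 2 - 3 * n) * ff g + 2 * n := by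
  have h := sum_trans (n := n) (fun τ => ff (g * τ))
  have h2 : ∑ i, ∑ j, ff (g * Equiv.swap i j) = ((n - 1) ^ 2 - 1) * ff g + 2 * n := by
    unfold ff
    have e : ∀ i : Fin n, ∑ j, ∑ x, (if (g * Equiv.swap i j) x = x then (1:ℝ) else 0)
      = ∑ x, ∑ j, (if (g * Equiv.swap i j) x = x then (1:ℝ) else 0) := fun i => Finset.sum_comm
    simp_rw [e]
    rw [Finset.sum_comm]
    have e2 := fun x : Fin n => swap_sum1 x (fun z => if g z = x then (1:ℝ) else 0)
    refine (Finset.sum_congr rfl fun x _ => e2 x).trans ?_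
    simp only [sum_ind]
    rw [Finset.sum_add_distrib, ← Finset.mul_sum]
    simp [mul_comm]
  simp only [mul_one] at h
  rw [h2] at h
  linarith

theorem pairsum_comm {n : ℕ} (Φ : Fin n → Fin n → Fin n → Fin n → ℝ) :
    ∑ i, ∑ j, ∑ x, ∑ y ∈ Finset.univ.erase x, Φ i j x y
    = ∑ x, ∑ y ∈ Finset.univ.erase x, ∑ i, ∑ j, Φ i j x y := by
  have e : ∀ i : Fin n, ∑ j, ∑ x, ∑ y ∈ Finset.univ.erase x, Φ i j x y
      = ∑ x, ∑ y ∈ Finset.univ.erase x, ∑ j, Φ i j x y := fun i => by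
    rw [Finset.sum_comm]
    exact Finset.sum_congr rfl fun x _ => Finset.sum_comm
  simp_rw [e]
  rw [Finset.sum_comm]
  exact Finset.sum_congr rfl fun x _ => Finset.sum_comm

theorem pair_swap {n : ℕ} (Φ : Fin n → Fin n → ℝ) :
    ∑ x, ∑ y ∈ Finset.univ.erase x, Φ x y = ∑ x, ∑ y ∈ Finset.univ.erase x, Φ y x := by
  have : ∀ Ψ : Fin n → Fin n → ℝ, ∑ x, ∑ y ∈ Finset.univ.erase x, Ψ x y
      = ∑ x, ∑ y, Ψ x y - ∑ x, Ψ x x := by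
    intro Ψ
    rw [← Finset.sum_sub_distrib]
    refine Finset.sum_congr rfl fun x _ => ?_
    rw [← Finset.add_sum_erase _ _ (Finset.mem_univ x)]; ring
  rw [this, this, Finset.sum_comm]

theorem drift_f2 {n : ℕ} (g : Equiv.Perm (Fin n)) :
    2 * ∑ τ ∈ transpositions n, f2 (g * τ) =
      ((n:ℝ) ^ 2 - 5 * n + 2) * f2 g + 2 * c2 g + 4 * (n - 1) * ff g := by
  have h := sum_trans (n := n) (fun τ => f2 (g * τ))
  have key : ∀ x, ∀ y ∈ Finset.univ.erase x, ∑ i, ∑ j, (if g (Equiv.swap i j x) = x then (1:ℝ) else 0) *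
      (if g (Equiv.swap i j y) = y then 1 else 0) =
      (2 + ((n:ℝ) - 2) ^ 2 - 4) * ((if g x = x then 1 else 0) * (if g y = y then 1 else 0))
      + 2 * ((if g x = y then 1 else 0) * (if g y = x then 1 else 0))
      + 2 * (if g x = x then 1 else 0) + 2 * (if g y = y then 1 else 0) := by
    intro x y hy
    have hxy : x ≠ y := by simp at hy; exact Ne.symm hy
    have e2 := swap_sum2 x y hxy
      (fun u v => (if g u = x then (1:ℝ) else 0) * (if g v = y then 1 else 0))
    rw [e2, ← Finset.sum_mul, ← Finset.mul_sum]
    have s1 := sum_erase2 x y hxy (fun u => (if g u = x then (1:ℝ) else 0))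
    have s2 := sum_erase2 x y hxy (fun u => (if g u = y then (1:ℝ) else 0))
    simp only [sum_ind] at s1 s2
    have s1eq := eq_sub_of_add_eq' s1.symm
    have s2eq := eq_sub_of_add_eq' s2.symm
    rw [s1eq, s2eq]
    have q1 : (if g x = x then (1:ℝ) else 0) * (if g x = y then 1 else 0) = 0 := by
      by_cases h1 : g x = x
      · simp [h1, hxy]
      · simp [h1]
    have q2 : (if g y = x then (1:ℝ) else 0) * (if g y = y then 1 else 0) = 0 := by
      by_cases h1 : g y = y
      · simp [h1, hxy.symm]
      · simp [h1]
    linear_combination (-2) * q1 - 2 * q2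
  have h2 : ∑ i, ∑ j, f2 (g * Equiv.swap i j) = (2 + ((n:ℝ) - 2) ^ 2 - 4) * f2 g + 2 * c2 g
      + 4 * (n - 1) * ff g := by
    unfold f2
    rw [pairsum_comm]
    refine (Finset.sum_congr rfl fun x _ => Finset.sum_congr rfl (key x)).trans ?_
    simp only [Finset.sum_add_distrib, ← Finset.mul_sum]
    have p := pair_swap (n := n) (fun x y => if g y = y then (1:ℝ) else 0)
    have p2 : ∑ x, ∑ y ∈ Finset.univ.erase x, (if g x = x then (1:ℝ) else 0) = (n - 1) * ff g := by
      rcases Nat.eq_zero_or_pos n with rfl | hn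
      · simp [ff]
      · unfold ff
        rw [Finset.mul_sum]
        refine Finset.sum_congr rfl fun x _ => ?_
        rw [Finset.sum_const, nsmul_eq_mul]
        congr 1
        simp [Nat.cast_sub (show 1 ≤ n from hn)]
    rw [p, p2]
    unfold c2
    ring
  simp only [mul_one] at h
  rw [h2] at h
  linarith

theorem drift_c2 {n : ℕ} (g : Equiv.Perm (Fin n)) :
    2 * ∑ τ ∈ transpositions n, c2 (g * τ) ≤
      ((n:ℝ) ^ 2 - 5 * n + 6) * c2 g + 2 * f2 g + 4 * n := by
  have h := sum_trans (n := n) (fun τ => c2 (g * τ))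
  have key : ∀ x, ∀ y ∈ Finset.univ.erase x, ∑ i, ∑ j, (if g (Equiv.swap i j x) = y then (1:ℝ) else 0) *
      (if g (Equiv.swap i j y) = x then 1 else 0) ≤
      (2 + ((n:ℝ) - 2) ^ 2) * ((if g x = y then 1 else 0) * (if g y = x then 1 else 0))
      + 2 * ((if g x = x then 1 else 0) * (if g y = y then 1 else 0))
      + 2 * (if g x = y then 1 else 0) + 2 * (if g y = x then 1 else 0) := by
    intro x y hy
    have hxy : x ≠ y := by simp at hy; exact Ne.symm hy
    have e2 := swap_sum2 x y hxy
      (fun u v => (if g u = y then (1:ℝ) else 0) * (if g v = x then 1 else 0))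
    rw [e2, ← Finset.sum_mul, ← Finset.mul_sum]
    have nn : ∀ (u v : Fin n), (0:ℝ) ≤ if g u = v then 1 else 0 := fun u v => by
      split_ifs <;> norm_num
    have s : ∀ z, ∑ u ∈ (Finset.univ.erase x).erase y, (if g u = z then (1:ℝ) else 0) ≤ 1 := by
      intro z
      have := sum_erase2 x y hxy (fun u => (if g u = z then (1:ℝ) else 0))
      simp only [sum_ind] at this
      linarith [nn x z, nn y z]
    have a1 := mul_le_mul_of_nonneg_right (s y) (nn y x)
    have a2 := mul_le_mul_of_nonneg_left (s x) (nn x y)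
    linarith
  have h2 : ∑ i, ∑ j, c2 (g * Equiv.swap i j) ≤ (2 + ((n:ℝ) - 2) ^ 2) * c2 g + 2 * f2 g
      + 4 * n := by
    unfold c2
    rw [pairsum_comm]
    refine (Finset.sum_le_sum fun (x : Fin n) _ => Finset.sum_le_sum (key x)).trans ?_
    simp only [Finset.sum_add_distrib, ← Finset.mul_sum]
    have p := pair_swap (n := n) (fun x y => if g x = y then (1:ℝ) else 0)
    have p2 : ∑ x, ∑ y ∈ Finset.univ.erase x, (if g y = x then (1:ℝ) else 0) ≤ n := by
      have : ∀ x : Fin n, ∑ y ∈ Finset.univ.erase x, (if g y = x then (1:ℝ) else 0) ≤ 1 := by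
        intro x
        refine le_trans (Finset.sum_le_sum_of_subset_of_nonneg (Finset.subset_univ _)
          fun i _ _ => ?_) (sum_ind g x).le
        split_ifs <;> norm_num
      have h3 := Finset.sum_le_sum (s := Finset.univ) fun (x : Fin n) _ => this x
      simpa using h3
    rw [p]
    unfold f2
    simp only [← Finset.mul_sum]
    linarith
  simp only [mul_one] at h
  linarith

theorem f2_eq {n : ℕ} (g : Equiv.Perm (Fin n)) : f2 g = ff g ^ 2 - ff g := by
  unfold f2 ff
  rw [sq, Finset.sum_mul_sum, ← Finset.sum_sub_distrib]
  refine Finset.sum_congr rfl fun x _ => ?_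
  rw [← Finset.add_sum_erase _ _ (Finset.mem_univ x)]
  split_ifs <;> simp

theorem trans_nonempty {n : ℕ} (hn : 2 ≤ n) : (transpositions n).Nonempty := by
  refine ⟨Equiv.swap ⟨0, by omega⟩ ⟨1, by omega⟩, ?_⟩
  rw [mem_trans]
  exact ⟨_, _, by simp, rfl⟩

theorem step_ev {n : ℕ} (hn : 2 ≤ n) (μ φ : Equiv.Perm (Fin n) → ℝ) :
    (n:ℝ) * (n - 1) * ev (conv μ (unifOn (transpositions n))) φ =
      ∑ g, μ g * (2 * ∑ τ ∈ transpositions n, φ (g * τ)) := by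
  rw [ev_conv, Finset.mul_sum]
  refine Finset.sum_congr rfl fun g _ => ?_
  have hT : ((transpositions n).card : ℝ) ≠ 0 := by
    have := (trans_nonempty hn).card_pos
    positivity
  rw [← card_trans]
  simp only [unifOn, ite_mul, zero_mul, Finset.sum_ite_mem, Finset.univ_inter, ← Finset.mul_sum]
  field_simp

theorem step_ff {n : ℕ} (hn : 2 ≤ n) (μ : Equiv.Perm (Fin n) → ℝ) (hμ : IsProb μ) :
    (n:ℝ) * (n - 1) * ev (conv μ (unifOn (transpositions n))) ff =
      ((n:ℝ) ^ 2 - 3 * n) * ev μ ff + 2 * n := by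
  rw [step_ev hn]
  simp only [drift_ff]
  have : ∀ g, μ g * (((n:ℝ) ^ 2 - 3 * n) * ff g + 2 * n) =
    ((n:ℝ) ^ 2 - 3 * n) * (μ g * ff g) + 2 * n * μ g := fun g => by ring
  simp only [this, Finset.sum_add_distrib, ← Finset.mul_sum, hμ.2, ev, mul_one]

theorem step_f2 {n : ℕ} (hn : 2 ≤ n) (μ : Equiv.Perm (Fin n) → ℝ) :
    (n:ℝ) * (n - 1) * ev (conv μ (unifOn (transpositions n))) f2 =
      ((n:ℝ) ^ 2 - 5 * n + 2) * ev μ f2 + 2 * ev μ c2 + 4 * (n - 1) * ev μ ff := by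
  rw [step_ev hn]
  simp only [drift_f2]
  have : ∀ g, μ g * (((n:ℝ) ^ 2 - 5 * n + 2) * f2 g + 2 * c2 g + 4 * (n - 1) * ff g) =
    ((n:ℝ) ^ 2 - 5 * n + 2) * (μ g * f2 g) + 2 * (μ g * c2 g) + 4 * (n - 1) * (μ g * ff g) :=
    fun g => by ring
  simp only [this, Finset.sum_add_distrib, ← Finset.mul_sum, ev]

theorem step_c2 {n : ℕ} (hn : 2 ≤ n) (μ : Equiv.Perm (Fin n) → ℝ) (hμ : IsProb μ) :
    (n:ℝ) * (n - 1) * ev (conv μ (unifOn (transpositions n))) c2 ≤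
      ((n:ℝ) ^ 2 - 5 * n + 6) * ev μ c2 + 2 * ev μ f2 + 4 * n := by
  rw [step_ev hn]
  refine (Finset.sum_le_sum fun g _ => mul_le_mul_of_nonneg_left (drift_c2 g) (hμ.1 g)).trans ?_
  have : ∀ g, μ g * (((n:ℝ) ^ 2 - 5 * n + 6) * c2 g + 2 * f2 g + 4 * n) =
    ((n:ℝ) ^ 2 - 5 * n + 6) * (μ g * c2 g) + 2 * (μ g * f2 g) + 4 * n * μ g := fun g => by ring
  simp only [this, Finset.sum_add_distrib, ← Finset.mul_sum, hμ.2, ev, mul_one]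
  exact le_refl _

theorem conv_unif {n : ℕ} (hn : 2 ≤ n) (S Sodd : Finset (Equiv.Perm (Fin n)))
    (hc : S.card = Sodd.card)
    (h : ∀ g τ : Equiv.Perm (Fin n), τ.IsSwap → (g * τ⁻¹ ∈ S ↔ g ∈ Sodd)) :
    conv (unifOn S) (unifOn (transpositions n)) = unifOn Sodd := by
  funext g
  have hT := (unifOn_isProb _ (trans_nonempty hn)).2
  have : ∀ τ, unifOn S (g * τ⁻¹) * unifOn (transpositions n) τ =
      unifOn Sodd g * unifOn (transpositions n) τ := by
    intro τ
    by_cases hτ : τ ∈ transpositions n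
    · congr 1
      rw [mem_trans] at hτ
      simp only [unifOn, h g τ hτ, hc]
    · simp [unifOn, hτ]
  simp only [conv, this]
  rw [← Finset.mul_sum, hT, mul_one]

theorem sign_swap_inv {n : ℕ} (g τ : Equiv.Perm (Fin n)) (h : τ.IsSwap) :
    Equiv.Perm.sign (g * τ⁻¹) = - Equiv.Perm.sign g := by
  simp [h.sign_eq]

theorem even_odd_card {n : ℕ} (hn : 2 ≤ n) : (evenPerms n).card = (oddPerms n).card := by
  obtain ⟨τ, hτ⟩ := trans_nonempty hn
  rw [mem_trans] at hτ
  refine Finset.card_equiv (Equiv.mulRight τ⁻¹) fun g => ?_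
  simp only [evenPerms, oddPerms, Finset.mem_filter, Finset.mem_univ, true_and,
    Equiv.coe_mulRight, sign_swap_inv g τ hτ]
  rcases Int.units_eq_one_or (Equiv.Perm.sign g) with h | h <;> simp [h]

theorem even_nonempty (n : ℕ) : (evenPerms n).Nonempty := ⟨1, by simp [evenPerms]⟩

theorem odd_nonempty {n : ℕ} (hn : 2 ≤ n) : (oddPerms n).Nonempty := by
  rw [← Finset.card_pos, ← even_odd_card hn, Finset.card_pos]
  exact even_nonempty n

theorem conv_even {n : ℕ} (hn : 2 ≤ n) :
    conv (unifOn (evenPerms n)) (unifOn (transpositions n)) = unifOn (oddPerms n) := by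
  refine conv_unif hn _ _ (even_odd_card hn) fun g τ hτ => ?_
  simp only [evenPerms, oddPerms, Finset.mem_filter, Finset.mem_univ, true_and,
    sign_swap_inv g τ hτ]
  rcases Int.units_eq_one_or (Equiv.Perm.sign g) with h | h <;> simp [h]

theorem conv_odd {n : ℕ} (hn : 2 ≤ n) :
    conv (unifOn (oddPerms n)) (unifOn (transpositions n)) = unifOn (evenPerms n) := by
  refine conv_unif hn _ _ (even_odd_card hn).symm fun g τ hτ => ?_
  simp only [evenPerms, oddPerms, Finset.mem_filter, Finset.mem_univ, true_and,
    sign_swap_inv g τ hτ]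
  rcases Int.units_eq_one_or (Equiv.Perm.sign g) with h | h <;> simp [h]

theorem stat_aux (N e1 o1 e2 o2 ec oc : ℝ) (hN : 5 ≤ N)
    (h1 : N * (N - 1) * o1 = (N ^ 2 - 3 * N) * e1 + 2 * N)
    (h2 : N * (N - 1) * e1 = (N ^ 2 - 3 * N) * o1 + 2 * N)
    (h3 : N * (N - 1) * o2 = (N ^ 2 - 5 * N + 2) * e2 + 2 * ec + 4 * (N - 1) * e1)
    (h4 : N * (N - 1) * e2 = (N ^ 2 - 5 * N + 2) * o2 + 2 * oc + 4 * (N - 1) * o1)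
    (h5 : N * (N - 1) * oc ≤ (N ^ 2 - 5 * N + 6) * ec + 2 * e2 + 4 * N)
    (h6 : N * (N - 1) * ec ≤ (N ^ 2 - 5 * N + 6) * oc + 2 * o2 + 4 * N) :
    (e1 = 1 ∧ o1 = 1) ∧ e2 ≤ 1 + 2 / N ∧ o2 ≤ 1 + 2 / N := by
  have a : e1 = o1 := by
    have : (e1 - o1) * (N * (2 * N - 4)) = 0 := by linear_combination h2 - h1
    have h0 : N * (2 * N - 4) ≠ 0 := by
      apply mul_ne_zero <;> linarith
    have := (mul_eq_zero.1 this).resolve_right h0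
    linarith
  have b : o1 = 1 := by
    rw [a] at h1
    have : (o1 - 1) * (2 * N) = 0 := by linear_combination h1
    have h0 : 2 * N ≠ 0 := by linarith
    have := (mul_eq_zero.1 this).resolve_right h0
    linarith
  rw [b] at a
  rw [a] at h3
  rw [b] at h4
  refine ⟨⟨a, b⟩, ?_⟩
  obtain ⟨Q, hQ⟩ : ∃ Q, Q = max e2 o2 := ⟨_, rfl⟩
  obtain ⟨C, hC⟩ : ∃ C, C = max ec oc := ⟨_, rfl⟩
  have q1 : e2 ≤ Q := hQ ▸ le_max_left _ _
  have q2 : o2 ≤ Q := hQ ▸ le_max_right _ _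
  have c1 : ec ≤ C := hC ▸ le_max_left _ _
  have c2 : oc ≤ C := hC ▸ le_max_right _ _
  have k1 : 0 ≤ N ^ 2 - 5 * N + 2 := by nlinarith
  have k2 : 0 ≤ N ^ 2 - 5 * N + 6 := by nlinarith
  have A : N * (N - 1) * Q ≤ (N ^ 2 - 5 * N + 2) * Q + 2 * C + 4 * (N - 1) := by
    have := mul_le_mul_of_nonneg_left q1 k1
    have := mul_le_mul_of_nonneg_left q2 k1
    rcases max_choice e2 o2 with h | h <;> rw [← hQ] at h
    · have e : N * (N - 1) * Q = N * (N - 1) * e2 := by rw [h]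
      linarith
    · have e : N * (N - 1) * Q = N * (N - 1) * o2 := by rw [h]
      linarith
  have B : N * (N - 1) * C ≤ (N ^ 2 - 5 * N + 6) * C + 2 * Q + 4 * N := by
    have := mul_le_mul_of_nonneg_left c1 k2
    have := mul_le_mul_of_nonneg_left c2 k2
    rcases max_choice ec oc with h | h <;> rw [← hC] at h
    · have e : N * (N - 1) * C = N * (N - 1) * ec := by rw [h]
      linarith
    · have e : N * (N - 1) * C = N * (N - 1) * oc := by rw [h]
      linarith
  have D : Q * (4 * N ^ 2 - 8 * N + 2) ≤ 4 * N ^ 2 - 8 * N + 6 := by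
    have := mul_le_mul_of_nonneg_left (show (2 * N - 1) * Q ≤ 2 * N - 2 + C by linarith) (show 0 ≤ 2 * N - 3 by linarith)
    nlinarith
  have E : Q ≤ 1 + 2 / N := by
    have hp : 0 < 4 * N ^ 2 - 8 * N + 2 := by nlinarith
    rw [← mul_le_mul_iff_left₀ hp]
    refine D.trans ?_
    have : (1 + 2 / N) * (4 * N ^ 2 - 8 * N + 2) = (4 * N ^ 2 - 8 * N + 2) + 8 * N - 16 + 4 / N := by
      field_simp
      ring
    rw [this]
    have : 0 ≤ 4 / N := by positivity
    linarith
  exact ⟨q1.trans E, q2.trans E⟩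

theorem stat_moments {n : ℕ} (hn : 5 ≤ n) (k s : ℕ) :
    IsProb (n := n) (stationary n k s) ∧ ev (n := n) (stationary n k s) ff = 1 ∧
      ev (n := n) (stationary n k s) f2 ≤ 1 + 2 / n := by
  have hn2 : 2 ≤ n := by omega
  have pe := unifOn_isProb _ (even_nonempty n)
  have po := unifOn_isProb _ (odd_nonempty hn2)
  have h1 := step_ff hn2 _ pe
  have h2 := step_ff hn2 _ po
  have h3 := step_f2 hn2 (unifOn (evenPerms n))
  have h4 := step_f2 hn2 (unifOn (oddPerms n))
  have h5 := step_c2 hn2 _ pe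
  have h6 := step_c2 hn2 _ po
  rw [conv_even hn2] at h1 h3 h5
  rw [conv_odd hn2] at h2 h4 h6
  obtain ⟨⟨a, b⟩, c, d⟩ := stat_aux n _ _ _ _ _ _ (by exact_mod_cast hn) h1 h2 h3 h4 h5 h6
  unfold stationary
  split_ifs
  · exact ⟨pe, a, c⟩
  · exact ⟨po, b, d⟩

theorem mem_cycles {n k : ℕ} (σ : Equiv.Perm (Fin n)) :
    σ ∈ cycles n k ↔ σ.IsCycle ∧ σ.support.card = n - k := by
  simp [cycles]

theorem cycles_nonempty {n k : ℕ} (hn : k + 3 ≤ n) : (cycles n k).Nonempty := by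
  have : NeZero n := ⟨by omega⟩
  have h0 : (⟨n - k - 1, by omega⟩ : Fin n) ≠ 0 := by
    intro h
    have := congrArg Fin.val h
    simp at this
    omega
  refine ⟨Fin.cycleRange ⟨n - k - 1, by omega⟩, ?_⟩
  rw [mem_cycles]
  refine ⟨Fin.isCycle_cycleRange h0, ?_⟩
  rw [← Equiv.Perm.sum_cycleType, Fin.cycleType_cycleRange h0]
  simp
  omega

theorem cycles_ff {n k : ℕ} (hn : k + 3 ≤ n) (σ : Equiv.Perm (Fin n)) (h : σ ∈ cycles n k) :
    ff σ = k := by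
  rw [mem_cycles] at h
  unfold ff
  rw [← Finset.sum_filter, Finset.sum_const, nsmul_eq_mul, mul_one]
  have : (Finset.univ.filter fun x => σ x = x) = σ.supportᶜ := by ext; simp
  rw [this, Finset.card_compl, h.2, Fintype.card_fin]
  congr 1
  omega

theorem cycles_c2 {n k : ℕ} (hn : k + 3 ≤ n) (σ : Equiv.Perm (Fin n)) (h : σ ∈ cycles n k) :
    c2 σ = 0 := by
  rw [mem_cycles] at h
  refine Finset.sum_eq_zero fun x _ => Finset.sum_eq_zero fun y hy => ?_
  have hxy : y ≠ x := by simpa using hy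
  by_cases h1 : σ x = y
  · by_cases h2 : σ y = x
    · exfalso
      have : σ ^ 2 = 1 := by
        rw [h.1.pow_eq_one_iff' (x := x) (by rw [h1]; exact hxy)]
        simp [sq, h1, h2]
      have := orderOf_le_of_pow_eq_one (by norm_num) this
      rw [h.1.orderOf, h.2] at this
      omega
    · simp [h2]
  · simp [h1]

theorem ev_unifOn_const {n : ℕ} (S : Finset (Equiv.Perm (Fin n))) (hS : S.Nonempty)
    (φ : Equiv.Perm (Fin n) → ℝ) (a : ℝ) (h : ∀ g ∈ S, φ g = a) : ev (unifOn S) φ = a := by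
  have : ∀ g, unifOn S g * φ g = unifOn S g * a := by
    intro g
    by_cases hg : g ∈ S
    · rw [h g hg]
    · simp [unifOn, hg]
  simp only [ev, this]
  rw [← Finset.sum_mul, (unifOn_isProb S hS).2, one_mul]

theorem walk_moments {n k : ℕ} (hk : 3 ≤ k) (hn : k ^ 2 + 10 ≤ n) (t : ℕ) :
    IsProb (walk n k t) ∧ ev (walk n k t) ff = 1 + (k - 1) * (1 - 2 / ((n:ℝ) - 1)) ^ t ∧
      ev (walk n k t) f2 ≤ 1 + 1 / ((n:ℝ) - 1) + 2 * (k - 1) * (1 - 2 / ((n:ℝ) - 1)) ^ t +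
        ((k:ℝ) ^ 2 - 3 * k + 1) * ((1 - 2 / ((n:ℝ) - 1)) ^ t) ^ 2 ∧
      ev (walk n k t) c2 ≤ 2 := by
  have hkn : k + 3 ≤ n := by nlinarith
  have hn2 : 2 ≤ n := by omega
  have hkR : (3:ℝ) ≤ k := by exact_mod_cast hk
  have hnR : (k:ℝ) ^ 2 + 10 ≤ n := by exact_mod_cast hn
  have hn10 : (10:ℝ) ≤ n := by nlinarith
  have hd : 0 < 1 / ((n:ℝ) - 1) := by
    apply one_div_pos.2; linarith
  have hd1 : 1 / ((n:ℝ) - 1) ≤ 1 := by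
    rw [div_le_one (by linarith)]; linarith
  induction t with
  | zero =>
    rw [walk_zero]
    have ne := cycles_nonempty hkn
    refine ⟨unifOn_isProb _ ne, ?_, ?_, ?_⟩
    · rw [ev_unifOn_const _ ne _ k (cycles_ff hkn)]; simp
    · rw [ev_unifOn_const _ ne _ ((k:ℝ)^2 - k) (fun g hg => by rw [f2_eq, cycles_ff hkn g hg])]
      simp only [pow_zero, one_pow, mul_one]
      linarith
    · rw [ev_unifOn_const _ ne _ 0 (cycles_c2 hkn)]; norm_num
  | succ t ih =>
    obtain ⟨hP, i1, i2, i3⟩ := ih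
    rw [walk_succ]
    have s1 := step_ff hn2 _ hP
    have s2 := step_f2 hn2 (walk n k t)
    have s3 := step_c2 hn2 _ hP
    refine ⟨conv_isProb _ _ hP (unifOn_isProb _ (trans_nonempty hn2)), ?_⟩
    generalize ev (conv (walk n k t) (unifOn (transpositions n))) ff = Fnew at *
    generalize ev (conv (walk n k t) (unifOn (transpositions n))) f2 = Qnew at *
    generalize ev (conv (walk n k t) (unifOn (transpositions n))) c2 = Cnew at *
    generalize ev (walk n k t) ff = F at *
    generalize ev (walk n k t) f2 = Q at *
    generalize ev (walk n k t) c2 = C at *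
    clear hP
    have hp0 : 0 ≤ (1 - 2 / ((n:ℝ) - 1)) ^ t := by
      apply pow_nonneg
      have : 2 / ((n:ℝ) - 1) ≤ 1 := by
        rw [div_le_one (by linarith)]; linarith
      linarith
    have hp1 : (1 - 2 / ((n:ℝ) - 1)) ^ t ≤ 1 := by
      apply pow_le_one₀
      · have : 2 / ((n:ℝ) - 1) ≤ 1 := by
          rw [div_le_one (by linarith)]; linarith
        linarith
      · have : 2 / ((n:ℝ) - 1) = 2 * (1 / ((n:ℝ) - 1)) := by ring
        linarith
    rw [pow_succ]
    have hr : 1 - 2 / ((n:ℝ) - 1) = 1 - 2 * (1 / ((n:ℝ) - 1)) := by ring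
    generalize (1 - 2 / ((n:ℝ) - 1)) ^ t = p at *
    rw [hr]
    have hdn : ((n:ℝ) - 1) * (1 / ((n:ℝ) - 1)) = 1 := by
      rw [mul_one_div_cancel]; linarith
    generalize 1 / ((n:ℝ) - 1) = δ at *
    generalize (n:ℝ) = N at *
    generalize (k:ℝ) = K at *
    have hB : 0 ≤ K ^ 2 - 3 * K + 1 := by nlinarith
    have hN : 0 < N * (N - 1) := by apply mul_pos <;> linarith
    refine ⟨?_, ?_, ?_⟩
    · apply mul_left_cancel₀ hN.ne'
      rw [s1, i1]
      linear_combination (2 * N * (K - 1) * p) * hdn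
    · apply le_of_mul_le_mul_left _ hN
      rw [s2, i1]
      have k1 : 0 ≤ N ^ 2 - 5 * N + 2 := by nlinarith
      have m := mul_le_mul_of_nonneg_left i2 k1
      have e1 : N * (N - 1) * (1 - 2 * δ) = N * (N - 3) := by linear_combination (-2 * N) * hdn
      have e2 : N * (N - 1) * (1 - 2 * δ) ^ 2 = N ^ 2 - 5 * N + 4 + 4 * δ := by
        linear_combination (1 - 2 * δ) * e1 + (4 - 2 * N) * hdn
      have e3 : N * (N - 1) * (1 + δ + 2 * (K - 1) * (p * (1 - 2 * δ)) +
          (K ^ 2 - 3 * K + 1) * (p * (1 - 2 * δ)) ^ 2) =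
          N * (N - 1) * (1 + δ) + 2 * (K - 1) * p * (N * (N - 3)) +
          (K ^ 2 - 3 * K + 1) * p ^ 2 * (N ^ 2 - 5 * N + 4 + 4 * δ) := by
        rw [← e1, ← e2]; ring
      rw [e3]
      have e4 : 0 ≤ (K ^ 2 - 3 * K + 1) * p ^ 2 * (2 + 4 * δ) := by positivity
      have e5 : (N ^ 2 - 5 * N + 2) * (1 + δ) + 4 + 4 * (N - 1) ≤ N * (N - 1) * (1 + δ) := by
        nlinarith
      linarith
    · apply le_of_mul_le_mul_left _ hN
      have k1 : 0 ≤ N ^ 2 - 5 * N + 6 := by nlinarith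
      have m := mul_le_mul_of_nonneg_left i3 k1
      have p2 : p ^ 2 ≤ 1 := pow_le_one₀ hp0 hp1
      have m2 := mul_le_mul_of_nonneg_left p2 hB
      have m3 := mul_le_mul_of_nonneg_left hp1 (show 0 ≤ 2 * (K - 1) by linarith)
      linarith

theorem ev_sq {n : ℕ} (μ : Equiv.Perm (Fin n) → ℝ) (hμ : IsProb μ) :
    ∑ g, μ g * (ff g - 1) ^ 2 = ev μ f2 - ev μ ff + 1 := by
  have : ∀ g, μ g * (ff g - 1) ^ 2 = μ g * f2 g - μ g * ff g + μ g := fun g => by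
    rw [f2_eq]; ring
  simp only [this, Finset.sum_add_distrib, Finset.sum_sub_distrib, hμ.2, ev]

theorem tv_bound {n : ℕ} (μ ν : Equiv.Perm (Fin n) → ℝ) (hμ : IsProb μ) (hν : IsProb ν) :
    (ev μ ff - ev ν ff) ^ 2 ≤ 2 * tvDist μ ν *
      ((ev μ f2 - ev μ ff + 1) + (ev ν f2 - ev ν ff + 1)) := by
  have h := Finset.sum_sq_le_sum_mul_sum_of_sq_le_mul Finset.univ
    (r := fun g => (μ g - ν g) * (ff g - 1)) (f := fun g => |μ g - ν g|)
    (g := fun g => |μ g - ν g| * (ff g - 1) ^ 2) (fun _ _ => abs_nonneg _)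
    (fun _ _ => by positivity) (fun g _ => by
      rw [mul_pow, ← sq_abs (μ g - ν g)]; apply le_of_eq; ring)
  have e : ∑ g, (μ g - ν g) * (ff g - 1) = ev μ ff - ev ν ff := by
    have : ∀ g, (μ g - ν g) * (ff g - 1) = μ g * ff g - ν g * ff g - (μ g - ν g) :=
      fun g => by ring
    simp only [this, Finset.sum_sub_distrib, hμ.2, hν.2, ev]
    ring
  rw [e] at h
  refine h.trans ?_
  rw [← ev_sq μ hμ, ← ev_sq ν hν, ← Finset.sum_add_distrib]
  have : 2 * tvDist μ ν = ∑ g, |μ g - ν g| := by unfold tvDist; ring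
  rw [this]
  refine mul_le_mul_of_nonneg_left (Finset.sum_le_sum fun g _ => ?_)
    (Finset.sum_nonneg fun _ _ => abs_nonneg _)
  rw [← add_mul]
  refine mul_le_mul_of_nonneg_right ?_ (sq_nonneg _)
  rw [abs_le]
  constructor <;> linarith [hμ.1 g, hν.1 g]

theorem tv_le_one {n : ℕ} (μ ν : Equiv.Perm (Fin n) → ℝ) (hμ : IsProb μ) (hν : IsProb ν) :
    tvDist μ ν ≤ 1 := by
  have : ∑ g, |μ g - ν g| ≤ ∑ g, (μ g + ν g) := Finset.sum_le_sum fun g _ => by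
    rw [abs_le]
    constructor <;> linarith [hμ.1 g, hν.1 g]
  rw [Finset.sum_add_distrib, hμ.2, hν.2] at this
  unfold tvDist
  linarith

theorem tendsto_p (c : ℝ) (hc : 0 < c) (k : ℕ) (hk : 3 ≤ k) :
    Tendsto (fun n : ℕ => (1 - 2 / ((n:ℝ) - 1)) ^ ⌊c * (n : ℝ) + (n : ℝ) / 2 * Real.log k⌋₊)
      atTop (nhds (Real.exp (-2 * c) / k)) := by
  have hkR : (3:ℝ) ≤ k := by exact_mod_cast hk
  have hl : 0 < Real.log k := Real.log_pos (by linarith)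
  have hinv : Tendsto (fun n : ℕ => 1 / (n:ℝ)) atTop (nhds 0) := tendsto_one_div_atTop_nhds_zero_nat
  have hg : Tendsto (fun n : ℕ => (n:ℝ) * (-2 / ((n:ℝ) - 1))) atTop (nhds (-2)) := by
    have h1 : Tendsto (fun n : ℕ => -2 / (1 - 1 / (n:ℝ))) atTop (nhds (-2 / (1 - 0))) :=
      Tendsto.div tendsto_const_nhds (tendsto_const_nhds.sub hinv) (by norm_num)
    simp only [sub_zero, div_one] at h1
    refine h1.congr' ?_
    filter_upwards [eventually_ge_atTop 2] with n hn
    have hnR : (2:ℝ) ≤ n := by exact_mod_cast hn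
    have : (n:ℝ) - 1 ≠ 0 := by linarith
    have : (n:ℝ) ≠ 0 := by linarith
    field_simp
  have hlog := Real.tendsto_nat_mul_log_one_add_of_tendsto hg
  have ht : Tendsto (fun n : ℕ => (⌊c * (n : ℝ) + (n : ℝ) / 2 * Real.log k⌋₊ : ℝ) / n) atTop
      (nhds (c + Real.log k / 2)) := by
    have h1 := (tendsto_nat_floor_mul_div_atTop (R := ℝ) (a := c + Real.log k / 2) (by positivity)).comp
      tendsto_natCast_atTop_atTop
    refine h1.congr fun n => ?_
    simp only [Function.comp]
    congr 4
    ring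
  have hm := (ht.mul hlog).rexp
  have hv : Real.exp ((c + Real.log k / 2) * -2) = Real.exp (-2 * c) / k := by
    rw [show (c + Real.log k / 2) * -2 = -2 * c - Real.log k by ring, Real.exp_sub,
      Real.exp_log (by linarith)]
  rw [hv] at hm
  refine hm.congr' ?_
  filter_upwards [eventually_ge_atTop 4] with n hn
  have hnR : (4:ℝ) ≤ n := by exact_mod_cast hn
  have h2 : 2 / ((n:ℝ) - 1) < 1 := by
    rw [div_lt_one (by linarith)]; linarith
  have e : (⌊c * (n : ℝ) + (n : ℝ) / 2 * Real.log k⌋₊ : ℝ) / n * (n * Real.log (1 + -2 / ((n:ℝ) - 1)))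
      = ⌊c * (n : ℝ) + (n : ℝ) / 2 * Real.log k⌋₊ * Real.log (1 - 2 / ((n:ℝ) - 1)) := by
    rw [show 1 + -2 / ((n:ℝ) - 1) = 1 - 2 / ((n:ℝ) - 1) by ring]
    have : (n:ℝ) ≠ 0 := by linarith
    field_simp
  rw [e, Real.exp_nat_mul, Real.exp_log (by linarith)]

theorem main_aux (c : ℝ) (hc : 0 < c) (k : ℕ) (hk : 3 ≤ k) (K : ℝ) (hK : 0 < K)
    (h : ∀ x : ℝ, 0 < x → x < 1 →
      2 * K * (2 * (k:ℝ) ^ 2 + k * (k - 1) * x + ((k:ℝ) ^ 2 - 3 * k + 1) * x ^ 2)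
        < ((k:ℝ) - 1) ^ 2) :
    K * Real.exp (-4 * c) ≤
      Filter.liminf (fun n : ℕ =>
        tvDist (walk n k ⌊c * (n : ℝ) + (n : ℝ) / 2 * Real.log k⌋₊)
          (stationary n k (⌊c * (n : ℝ) + (n : ℝ) / 2 * Real.log k⌋₊ + 1)))
        Filter.atTop := by
  have hkR : (3:ℝ) ≤ k := by exact_mod_cast hk
  have hp := tendsto_p c hc k hk
  have hx0 : 0 < Real.exp (-2 * c) := Real.exp_pos _
  have hx1 : Real.exp (-2 * c) < 1 := by rw [Real.exp_lt_one_iff]; linarith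
  have hx4 : Real.exp (-4 * c) = Real.exp (-2 * c) ^ 2 := by
    rw [← Real.exp_nat_mul]; congr 1; push_cast; ring
  rw [hx4]
  generalize Real.exp (-2 * c) = x at *
  have hB : 0 ≤ (k:ℝ) ^ 2 - 3 * k + 1 := by nlinarith
  apply Filter.le_liminf_of_le
  · refine Filter.IsBoundedUnder.isCoboundedUnder_ge ⟨1, ?_⟩
    rw [Filter.eventually_map]
    filter_upwards [eventually_ge_atTop (k ^ 2 + 10)] with n hn
    exact tv_le_one _ _ (walk_moments hk hn _).1 (stat_moments (by nlinarith) _ _).1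
  · have hd : Tendsto (fun n : ℕ => 1 / ((n:ℝ) - 1)) atTop (nhds 0) := by
      have h1 : Tendsto (fun n : ℕ => (n:ℝ) - 1) atTop atTop :=
        tendsto_atTop_add_const_right _ _ tendsto_natCast_atTop_atTop
      exact h1.inv_tendsto_atTop.congr fun n => by simp
    have hL : Tendsto (fun n : ℕ => K * x ^ 2 * 2 * (2 + 3 * (1 / ((n:ℝ) - 1)) +
        ((k:ℝ) - 1) * (1 - 2 / ((n:ℝ) - 1)) ^ ⌊c * (n : ℝ) + (n : ℝ) / 2 * Real.log k⌋₊ +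
        ((k:ℝ) ^ 2 - 3 * k + 1) *
          ((1 - 2 / ((n:ℝ) - 1)) ^ ⌊c * (n : ℝ) + (n : ℝ) / 2 * Real.log k⌋₊) ^ 2)) atTop
        (nhds (K * x ^ 2 * 2 * (2 + 3 * 0 + ((k:ℝ) - 1) * (x / k) +
          ((k:ℝ) ^ 2 - 3 * k + 1) * (x / k) ^ 2))) :=
      (((tendsto_const_nhds.add (hd.const_mul 3)).add (hp.const_mul _)).add
        ((hp.pow 2).const_mul _)).const_mul _
    have hR := (hp.const_mul ((k:ℝ) - 1)).pow 2
    have hlt : K * x ^ 2 * 2 * (2 + 3 * 0 + ((k:ℝ) - 1) * (x / k) +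
          ((k:ℝ) ^ 2 - 3 * k + 1) * (x / k) ^ 2) < (((k:ℝ) - 1) * (x / k)) ^ 2 := by
      have hk0 : (k:ℝ) ≠ 0 := by linarith
      have e := mul_lt_mul_of_pos_left (h x hx0 hx1) (show 0 < (x / k) ^ 2 by positivity)
      have e1 : (x / k) ^ 2 * (2 * K * (2 * (k:ℝ) ^ 2 + k * (k - 1) * x +
          ((k:ℝ) ^ 2 - 3 * k + 1) * x ^ 2)) = K * x ^ 2 * 2 * (2 + 3 * 0 + ((k:ℝ) - 1) * (x / k) +
          ((k:ℝ) ^ 2 - 3 * k + 1) * (x / k) ^ 2) := by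
        field_simp
        ring
      rw [e1] at e
      refine e.trans_eq ?_
      ring
    filter_upwards [hL.eventually_lt hR hlt, eventually_ge_atTop (k ^ 2 + 10)] with n h1 hn
    obtain ⟨a1, a2, a3, -⟩ := walk_moments hk hn ⌊c * (n : ℝ) + (n : ℝ) / 2 * Real.log k⌋₊
    obtain ⟨b1, b2, b3⟩ := stat_moments (n := n) (by nlinarith) k
      (⌊c * (n : ℝ) + (n : ℝ) / 2 * Real.log k⌋₊ + 1)
    have T := tv_bound _ _ a1 b1
    have hT0 : 0 ≤ tvDist (walk n k ⌊c * (n : ℝ) + (n : ℝ) / 2 * Real.log k⌋₊)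
          (stationary n k (⌊c * (n : ℝ) + (n : ℝ) / 2 * Real.log k⌋₊ + 1)) := by
      unfold tvDist
      have := Finset.sum_nonneg (s := Finset.univ) (fun σ _ => abs_nonneg
        (walk n k ⌊c * (n : ℝ) + (n : ℝ) / 2 * Real.log k⌋₊ σ -
          stationary n k (⌊c * (n : ℝ) + (n : ℝ) / 2 * Real.log k⌋₊ + 1) σ))
      linarith
    have hnR : (k:ℝ) ^ 2 + 10 ≤ n := by exact_mod_cast hn
    have hn10 : (10:ℝ) ≤ n := by nlinarith
    have hr0 : 0 ≤ (1 - 2 / ((n:ℝ) - 1)) ^ ⌊c * (n : ℝ) + (n : ℝ) / 2 * Real.log k⌋₊ := by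
      apply pow_nonneg
      have : 2 / ((n:ℝ) - 1) ≤ 1 := by
        rw [div_le_one (by linarith)]; linarith
      linarith
    have hdn : 2 / (n:ℝ) ≤ 2 * (1 / ((n:ℝ) - 1)) := by
      rw [mul_one_div]
      exact div_le_div_of_nonneg_left (by norm_num) (by linarith) (by linarith)
    have hdp : 0 < 1 / ((n:ℝ) - 1) := one_div_pos.2 (by linarith)
    rw [a2, b2] at T
    generalize tvDist (walk n k ⌊c * (n : ℝ) + (n : ℝ) / 2 * Real.log k⌋₊)
          (stationary n k (⌊c * (n : ℝ) + (n : ℝ) / 2 * Real.log k⌋₊ + 1)) = V at *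
    generalize (1 - 2 / ((n:ℝ) - 1)) ^ ⌊c * (n : ℝ) + (n : ℝ) / 2 * Real.log k⌋₊ = p at *
    generalize 1 / ((n:ℝ) - 1) = δ at *
    have hW : 0 < 2 + 3 * δ + ((k:ℝ) - 1) * p + ((k:ℝ) ^ 2 - 3 * k + 1) * p ^ 2 := by
      have : 0 ≤ ((k:ℝ) - 1) * p := mul_nonneg (by linarith) hr0
      have : 0 ≤ ((k:ℝ) ^ 2 - 3 * k + 1) * p ^ 2 := by positivity
      linarith
    have T2 := T.trans (mul_le_mul_of_nonneg_left (show _ ≤ 2 + 3 * δ + ((k:ℝ) - 1) * p +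
      ((k:ℝ) ^ 2 - 3 * k + 1) * p ^ 2 by linarith) (by linarith))
    by_contra hcon
    push Not at hcon
    have := mul_lt_mul_of_pos_right hcon hW
    nlinarith

/-- Lower bounds for the `(n-k)`-cycle walk with `t_n = ⌊cn + (n/2)ln k⌋`:
`liminf ‖μ_{t_n+1} - U_{t_n+1}‖_TV ≥ (4/55)e^{-4c}` for `k = 3`, and
`liminf ‖μ_{t_n+1} - U_{t_n+1}‖_TV ≥ (3/35)e^{-4c}` for every fixed `k ≥ 4`. -/
theorem cycle_walk_tv_lower_bounds (c : ℝ) (hc : 0 < c) :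
    ((4 / 55) * Real.exp (-4 * c) ≤
      Filter.liminf (fun n : ℕ =>
        tvDist (walk n 3 ⌊c * (n : ℝ) + (n : ℝ) / 2 * Real.log 3⌋₊)
          (stationary n 3 (⌊c * (n : ℝ) + (n : ℝ) / 2 * Real.log 3⌋₊ + 1)))
        Filter.atTop) ∧
    (∀ k : ℕ, 4 ≤ k → (3 / 35) * Real.exp (-4 * c) ≤
      Filter.liminf (fun n : ℕ =>
        tvDist (walk n k ⌊c * (n : ℝ) + (n : ℝ) / 2 * Real.log k⌋₊)
          (stationary n k (⌊c * (n : ℝ) + (n : ℝ) / 2 * Real.log k⌋₊ + 1)))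
        Filter.atTop) := by
  constructor
  · have h := main_aux c hc 3 le_rfl (4 / 55) (by norm_num) (by
      intro x h0 h1
      push_cast
      nlinarith)
    simpa using h
  · intro k hk
    refine main_aux c hc k (by omega) (3 / 35) (by norm_num) ?_
    intro x h0 h1
    have hkR : (4:ℝ) ≤ k := by exact_mod_cast hk
    have hB : 0 ≤ (k:ℝ) ^ 2 - 3 * k + 1 := by nlinarith
    have hx2 : x ^ 2 ≤ 1 := pow_le_one₀ h0.le h1.le
    have m1 := mul_le_mul_of_nonneg_left hx2 hB
    have m2 := mul_le_mul_of_nonneg_left h1.le (show 0 ≤ (k:ℝ) * (k - 1) by nlinarith)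
    nlinarith
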